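/- arXiv:2404.10168 — 2 statements merged into one kernel-verified Lean document; each statement's English description precedes it below -/
import Mathlib

section
/- Let k ≥ 0 and n ≥ 3 be integers and let x : Fin n → ℤ with Σ_{i} x_i = k·(n − 2). Suppose there exists an index i₀ with 2·x_{i₀} < k. Then there exists a genus-zero leaky cover datum for leaking k, degree x, and Psi-conditions e = 0 (so every vertex satisfies val(v) = 3). -/
/-- A genus-zero leaky cover datum for leaking `k`, degree `x : Fin n → ℤ` and
Psi-conditions `e : Fin n → ℕ`. The vertex set is `Fin N` with `N ≥ 1`; the tree
is encoded by the antisymmetric flow `w : Fin N → Fin N → ℤ` (two vertices are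
adjacent iff the flow between them is nonzero); `a` assigns each of the `n` legs
to a vertex. The valence of a vertex `v` is the number of neighbours plus the
number of legs at `v`; each vertex must satisfy the Psi-condition
`val v = (∑_{a i = v} e i) + 3` and the `k`-leaky balancing condition
`(∑_{a i = v} x i) + ∑_u w u v = k * (val v - 2)`. -/
structure LeakyCoverDatum (k : ℤ) {n : ℕ} (x : Fin n → ℤ) (e : Fin n → ℕ) : Type where
  /-- the number of vertices -/
  N : ℕ
  Npos : 0 < N
  /-- the leg assignment -/
  a : Fin n → Fin N
  /-- the flow on oriented pairs of vertices; nonzero exactly on edges of the tree -/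
  w : Fin N → Fin N → ℤ
  skew : ∀ u v, w u v = - w v u
  /-- the graph with an edge where the flow is nonzero is connected -/
  conn : (SimpleGraph.fromRel fun u v => w u v ≠ 0).Connected
  /-- the graph is a tree: the number of (unordered) edges is `N - 1`,
  counted here as ordered pairs -/
  tree : (Finset.univ.filter fun p : Fin N × Fin N => w p.1 p.2 ≠ 0).card = 2 * (N - 1)
  /-- the Psi-condition at each vertex -/
  psi : ∀ v : Fin N,
    (Finset.univ.filter fun u => w u v ≠ 0).card
      + (Finset.univ.filter fun i => a i = v).card
    = (∑ i ∈ Finset.univ.filter fun i => a i = v, e i) + 3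
  /-- the `k`-leaky balancing condition at each vertex -/
  balance : ∀ v : Fin N,
    (∑ i ∈ Finset.univ.filter fun i => a i = v, x i) + (∑ u, w u v)
    = k * ((((Finset.univ.filter fun u => w u v ≠ 0).card
        + (Finset.univ.filter fun i => a i = v).card : ℕ) : ℤ) - 2)

theorem sum_map_nonneg {ι : Type*} (y : ι → ℤ) {l : List ι} (h : ∀ i ∈ l, 0 ≤ y i) :
    0 ≤ (l.map y).sum :=
  List.sum_nonneg (by simpa using h)

theorem sum_map_nonpos {ι : Type*} (y : ι → ℤ) {l : List ι} (h : ∀ i ∈ l, y i ≤ 0) :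
    (l.map y).sum ≤ 0 := by
  induction l with
  | nil => simp
  | cons a l ih =>
    have := ih fun i hi => h i (List.mem_cons_of_mem _ hi)
    have := h a List.mem_cons_self
    simp only [List.map_cons, List.sum_cons]
    linarith

/-- An ordering of a list with sum `-2k` and an entry below `-k/2` such that the partial sums of
at least two and all but at least two entries avoid `-k`: the case of a strictly positive `k`. -/
theorem exists_perm_sum_ne_of_pos {ι : Type*} [DecidableEq ι] {k : ℤ} (hk : 0 < k) (y : ι → ℤ)
    (U : List ι) (hsum : (U.map y).sum = -2 * k) {i₀ : ι} (hmem : i₀ ∈ U) (hi : 2 * y i₀ < -k) :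
    ∃ l : List ι, l.Perm U ∧
      ∀ p s, l = p ++ s → 2 ≤ p.length → 2 ≤ s.length → (p.map y).sum ≠ -k := by
  set S := U.filter (fun i => decide (y i < 0)) with hS
  set R := U.filter (fun i => !decide (y i < 0)) with hR
  have hSR : (S ++ R).Perm U := List.filter_append_perm _ _
  have hRnonneg : ∀ i ∈ R, 0 ≤ y i := by
    intro i h
    simpa [hR] using (List.mem_filter.1 h).2
  have hSneg : ∀ i ∈ S, y i < 0 := by
    intro i h
    simpa [hS] using (List.mem_filter.1 h).2
  have hSsum : (S.map y).sum ≤ -2 * k := by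
    have h := (hSR.map y).sum_eq
    rw [List.map_append, List.sum_append, hsum] at h
    have := sum_map_nonneg y hRnonneg
    linarith
  have hiS : i₀ ∈ S := List.mem_filter.2 ⟨hmem, by simp; linarith⟩
  -- it suffices to order the negative entries
  suffices h : ∃ N : List ι, N.Perm S ∧
      ∀ p s, N = p ++ s → 2 ≤ p.length → s ≠ [] → (p.map y).sum ≠ -k by
    obtain ⟨N, hN, hgood⟩ := h
    refine ⟨N ++ R, (hN.append_right R).trans hSR, ?_⟩
    intro p s hps hp hs
    have hNsum : (N.map y).sum ≤ -2 * k := by rw [(hN.map y).sum_eq]; exact hSsum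
    have htot : (p.map y).sum + (s.map y).sum = -2 * k := by
      rw [← List.sum_append, ← List.map_append, ← hps,
        (((hN.append_right R).trans hSR).map y).sum_eq, hsum]
    rcases List.append_eq_append_iff.1 hps with ⟨a', rfl, ha⟩ | ⟨c', rfl, rfl⟩
    · have : 0 ≤ (s.map y).sum :=
        sum_map_nonneg y fun i h => hRnonneg i (ha ▸ List.mem_append_right _ h)
      intro h
      linarith
    · rcases eq_or_ne c' [] with rfl | hc
      · simp only [List.append_nil] at hNsum
        intro h
        linarith
      · exact hgood p c' rfl hp hc
  have hperm := List.perm_cons_erase hiS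
  set o := S.erase i₀ with ho
  have honeg : ∀ i ∈ o, y i < 0 := fun i h => hSneg i (List.mem_of_mem_erase h)
  by_cases hA : ∃ j ∈ o, y i₀ + y j < -k
  · obtain ⟨j, hj, hlt⟩ := hA
    have hperm' := List.perm_cons_erase hj
    refine ⟨i₀ :: j :: o.erase j, (hperm.trans (hperm'.cons i₀)).symm, ?_⟩
    intro p s hps hp _
    match p, hp with
    | a :: b :: q, _ =>
      simp only [List.cons_append, List.cons.injEq] at hps
      obtain ⟨rfl, rfl, hq⟩ := hps
      have : (q.map y).sum ≤ 0 := sum_map_nonpos y fun i h =>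
        (honeg i (List.mem_of_mem_erase (hq ▸ List.mem_append_left _ h))).le
      simp only [List.map_cons, List.sum_cons]
      intro h
      linarith
  · push Not at hA
    by_cases hB : ∀ p s, i₀ :: o = p ++ s → 2 ≤ p.length → s ≠ [] → (p.map y).sum ≠ -k
    · exact ⟨i₀ :: o, hperm.symm, hB⟩
    · push Not at hB
      obtain ⟨p, s, hps, hp, hs, hpk⟩ := hB
      obtain ⟨o₁, rfl⟩ : ∃ o₁, p = i₀ :: o₁ := by
        cases p with
        | nil => simp at hp
        | cons a q =>
          simp only [List.cons_append, List.cons.injEq] at hps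
          exact ⟨q, by rw [hps.1]⟩
      obtain ⟨c, o₃, rfl⟩ := List.exists_cons_of_ne_nil hs
      simp only [List.cons_append, List.cons.injEq, true_and] at hps
      simp only [List.map_cons, List.sum_cons] at hpk
      have hc := hA c (by rw [hps]; simp)
      have hcneg := honeg c (by rw [hps]; simp)
      have ho₁ : ∀ i ∈ o₁, y i < 0 := fun i h => honeg i (by rw [hps]; simp [h])
      have ho₃ : ∀ i ∈ o₃, y i < 0 := fun i h => honeg i (by rw [hps]; simp [h])
      refine ⟨(o₁ ++ [c]) ++ i₀ :: o₃, ?_, ?_⟩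
      · refine List.Perm.trans ?_ hperm.symm
        rw [hps]
        refine List.perm_middle.trans ?_
        simp
      · intro p s hps _ _
        rcases List.append_eq_append_iff.1 hps with ⟨a', rfl, ha⟩ | ⟨c', hc', rfl⟩
        · cases a' with
          | nil =>
            simp only [List.map_append, List.map_cons, List.sum_append, List.sum_cons,
              List.map_nil, List.sum_nil]
            intro h
            linarith
          | cons a q =>
            simp only [List.cons_append, List.cons.injEq] at ha
            obtain ⟨rfl, rfl⟩ := ha
            have : (q.map y).sum ≤ 0 := sum_map_nonpos y fun i h =>
              (ho₃ i (List.mem_append_left _ h)).le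
            simp only [List.map_append, List.map_cons, List.sum_append, List.sum_cons,
              List.map_nil, List.sum_nil]
            intro h
            linarith
        · have hsum' : (o₁.map y).sum + y c = (p.map y).sum + (c'.map y).sum := by
            simpa using congrArg (fun t => (t.map y).sum) hc'
          have : (c'.map y).sum ≤ 0 := by
            refine sum_map_nonpos y fun i h => ?_
            have : i ∈ o₁ ++ [c] := hc' ▸ List.mem_append_right _ h
            rcases List.mem_append.1 this with h | h
            · exact (ho₁ i h).le
            · rw [List.mem_singleton.1 h]
              exact hcneg.le
          intro h
          linarith

/-- An ordering of a list with sum `0` and a negative entry such that the partial sums of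
at least two and all but at least two entries are nonzero. -/
theorem exists_perm_sum_ne_zero {ι : Type*} [DecidableEq ι] (y : ι → ℤ)
    (U : List ι) (hsum : (U.map y).sum = 0) {i₀ : ι} (hmem : i₀ ∈ U) (hi : y i₀ < 0) :
    ∃ l : List ι, l.Perm U ∧
      ∀ p s, l = p ++ s → 2 ≤ p.length → 2 ≤ s.length → (p.map y).sum ≠ 0 := by
  set S := U.filter (fun i => decide (y i ≤ 0)) with hS
  set R := U.filter (fun i => !decide (y i ≤ 0)) with hR
  have hSR : (S ++ R).Perm U := List.filter_append_perm _ _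
  have hRpos : ∀ i ∈ R, 0 < y i := by
    intro i h
    simpa [hR] using (List.mem_filter.1 h).2
  have hiS : i₀ ∈ S := List.mem_filter.2 ⟨hmem, by simpa using hi.le⟩
  have hperm := List.perm_cons_erase hiS
  have honeg : ∀ i ∈ S.erase i₀, y i ≤ 0 := by
    intro i h
    simpa [hS] using (List.mem_filter.1 (List.mem_of_mem_erase h)).2
  have hl := (hperm.symm.append_right R).trans hSR
  refine ⟨_, hl, ?_⟩
  intro p s hps hp hs
  have htot : (p.map y).sum + (s.map y).sum = 0 := by
    rw [← List.sum_append, ← List.map_append, ← hps, (hl.map y).sum_eq, hsum]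
  rcases List.append_eq_append_iff.1 hps with ⟨a', rfl, ha⟩ | ⟨c', hc', rfl⟩
  · have : 0 < (s.map y).sum := by
      cases s with
      | nil => simp at hs
      | cons b t =>
        have hb := hRpos b (by rw [ha]; simp)
        have := sum_map_nonneg y (l := t) fun i h => (hRpos i (by rw [ha]; simp [h])).le
        simp only [List.map_cons, List.sum_cons]
        linarith
    intro h
    linarith
  · cases p with
    | nil => simp at hp
    | cons a q =>
      simp only [List.cons_append, List.cons.injEq] at hc'
      obtain ⟨rfl, hq⟩ := hc'
      have := sum_map_nonpos y (l := q) fun i h => honeg i (by rw [hq]; simp [h])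
      simp only [List.map_cons, List.sum_cons]
      intro h
      linarith

namespace LeakyCoverDatum

/-- Relabelling the legs of a cover without Psi-conditions. -/
def reindex {k : ℤ} {n n' : ℕ} {x : Fin n → ℤ} (σ : Fin n' ≃ Fin n)
    (D : LeakyCoverDatum k (x ∘ σ) (fun _ => 0)) : LeakyCoverDatum k x (fun _ => 0) :=
  have hcard (v : Fin D.N) : (Finset.univ.filter fun i => D.a (σ.symm i) = v).card =
      (Finset.univ.filter fun i => D.a i = v).card := by
    simp only [Finset.card_filter]
    exact Equiv.sum_comp σ.symm fun i => if D.a i = v then 1 else 0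
  { N := D.N
    Npos := D.Npos
    a := D.a ∘ σ.symm
    w := D.w
    skew := D.skew
    conn := D.conn
    tree := D.tree
    psi := fun v => by
      have h := D.psi v
      simp only [Finset.sum_const_zero, Function.comp_apply] at h ⊢
      rw [hcard, h]
    balance := fun v => by
      have h := D.balance v
      simp only [Function.comp_apply] at h ⊢
      rw [hcard, ← h]
      congr 1
      simp only [Finset.sum_filter]
      rw [← Equiv.sum_comp σ]
      simp }

end LeakyCoverDatum

/-- The vertex of a caterpillar carrying a given leg: the two extremal legs at each end share a
vertex. -/
def caterpillarLeg (m : ℕ) (i : Fin (m + 3)) : Fin (m + 1) :=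
  ⟨min ((i : ℕ) - 1) m, by omega⟩

/-- The flow on the path with `m + 1` vertices whose value from `j` to `j + 1` is `F j`. -/
def pathFlow (m : ℕ) (F : ℕ → ℤ) (u v : Fin (m + 1)) : ℤ :=
  if (u : ℕ) + 1 = v then F u else if (v : ℕ) + 1 = u then -F v else 0

theorem sum_caterpillarLeg {M : Type*} [AddCommMonoid M] (m : ℕ) (g : ℕ → M) (v : Fin (m + 1)) :
    (∑ i : Fin (m + 3), if caterpillarLeg m i = v then g i else 0) =
      (if (v : ℕ) = 0 then g 0 else 0) + (g (v + 1) + if (v : ℕ) = m then g (m + 2) else 0) := by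
  rw [Fin.sum_univ_succ, Fin.sum_univ_castSucc]
  congr 1
  · refine if_congr ?_ rfl rfl
    rw [Fin.ext_iff]
    change min (0 - 1) m = (v : ℕ) ↔ _
    omega
  · congr 1
    · rw [Finset.sum_eq_single v]
      · have : caterpillarLeg m v.castSucc.succ = v := by
          ext; simp [caterpillarLeg]; omega
        simp [this]
      · intro b _ hb
        have : caterpillarLeg m b.castSucc.succ = b := by
          ext; simp [caterpillarLeg]; omega
        simp [this, hb]
      · simp
    · simp [caterpillarLeg, Fin.ext_iff, eq_comm]

theorem sum_path_neighbours {M : Type*} [AddCommMonoid M] (m : ℕ) (A B : ℕ → M)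
    (v : Fin (m + 1)) :
    (∑ u : Fin (m + 1), if (u : ℕ) + 1 = v then A u else if (v : ℕ) + 1 = u then B v else 0) =
      (if (v : ℕ) = 0 then 0 else A (v - 1)) + if (v : ℕ) = m then 0 else B v := by
  have hsplit : ∀ u : Fin (m + 1),
      (if (u : ℕ) + 1 = v then A u else if (v : ℕ) + 1 = u then B v else 0) =
        (if (u : ℕ) + 1 = v then A u else 0) + if (v : ℕ) + 1 = u then B v else 0 := by
    intro u
    split_ifs <;> first | omega | simp
  rw [Finset.sum_congr rfl fun u _ => hsplit u, Finset.sum_add_distrib]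
  congr 1
  · split_ifs with h
    · exact Finset.sum_eq_zero fun u _ => if_neg (by omega)
    · rw [Finset.sum_eq_single ⟨v - 1, by omega⟩]
      · exact if_pos (by simp; omega)
      · intro b _ hb
        refine if_neg fun h' => hb (Fin.ext ?_)
        simp; omega
      · simp
  · split_ifs with h
    · exact Finset.sum_eq_zero fun u _ => if_neg (by omega)
    · rw [Finset.sum_eq_single ⟨v + 1, by omega⟩]
      · exact if_pos rfl
      · intro b _ hb
        exact if_neg fun h' => hb (Fin.ext h'.symm)
      · simp

theorem pathFlow_ne_zero_iff {m : ℕ} {F : ℕ → ℤ} (hF : ∀ j < m, F j ≠ 0) (u v : Fin (m + 1)) :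
    pathFlow m F u v ≠ 0 ↔ (u : ℕ) + 1 = v ∨ (v : ℕ) + 1 = u := by
  unfold pathFlow
  split_ifs with h₁ h₂
  · simpa [h₁] using hF u (by omega)
  · simpa [h₂] using hF v (by omega)
  · simp [h₁, h₂]

theorem card_pathFlow_neighbours {m : ℕ} {F : ℕ → ℤ} (hF : ∀ j < m, F j ≠ 0) (v : Fin (m + 1)) :
    (Finset.univ.filter fun u => pathFlow m F u v ≠ 0).card =
      (if (v : ℕ) = 0 then 0 else 1) + if (v : ℕ) = m then 0 else 1 := by
  rw [Finset.card_filter, ← sum_path_neighbours m (fun _ => 1) (fun _ => 1) v]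
  refine Finset.sum_congr rfl fun u _ => ?_
  simp only [pathFlow_ne_zero_iff hF]
  split_ifs <;> first | rfl | omega

theorem connected_pathFlow {m : ℕ} {F : ℕ → ℤ} (hF : ∀ j < m, F j ≠ 0) :
    (SimpleGraph.fromRel fun u v => pathFlow m F u v ≠ 0).Connected := by
  have h : ∀ (j : ℕ) (hj : j < m + 1),
      (SimpleGraph.fromRel fun u v => pathFlow m F u v ≠ 0).Reachable 0 ⟨j, hj⟩ := by
    intro j
    induction j with
    | zero => exact fun _ => SimpleGraph.Reachable.refl _
    | succ j ih =>
      intro hj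
      refine (ih (by omega)).trans (SimpleGraph.Adj.reachable ?_)
      rw [SimpleGraph.fromRel_adj]
      refine ⟨by simp [Fin.ext_iff], Or.inl ?_⟩
      rw [pathFlow_ne_zero_iff hF]
      exact Or.inl rfl
  have : Nonempty (Fin (m + 1)) := ⟨0⟩
  exact ⟨fun u v => (h u u.2).symm.trans (h v v.2)⟩

/-- The caterpillar cover whose legs are attached in the given order exists as soon as all the
flows forced by balancing are nonzero. -/
theorem nonempty_leakyCoverDatum_of_sum_ne {k : ℤ} {m : ℕ} (X : ℕ → ℤ)
    (hsum : ∑ i ∈ Finset.range (m + 3), X i = k * (m + 1))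
    (hX : ∀ j < m, ∑ i ∈ Finset.range (j + 2), X i ≠ k * (j + 1)) :
    Nonempty (LeakyCoverDatum k (fun i : Fin (m + 3) => X i) (fun _ => 0)) := by
  set F : ℕ → ℤ := fun j => ∑ i ∈ Finset.range (j + 2), X i - k * (j + 1) with hFdef
  have hF : ∀ j < m, F j ≠ 0 := fun j hj => sub_ne_zero.2 (hX j hj)
  have hval : ∀ v : Fin (m + 1), (Finset.univ.filter fun u => pathFlow m F u v ≠ 0).card
      + (Finset.univ.filter fun i => caterpillarLeg m i = v).card = 3 := by
    intro v
    rw [card_pathFlow_neighbours hF, Finset.card_filter, sum_caterpillarLeg m (fun _ => 1) v]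
    split_ifs <;> rfl
  refine ⟨{
    N := m + 1
    Npos := by omega
    a := caterpillarLeg m
    w := pathFlow m F
    skew := ?_
    conn := connected_pathFlow hF
    tree := ?_
    psi := fun v => by simpa using hval v
    balance := ?_ }⟩
  · intro u v
    unfold pathFlow
    split_ifs <;> omega
  · rw [Finset.card_filter, Fintype.sum_prod_type_right]
    simp only [← Finset.card_filter, card_pathFlow_neighbours hF]
    rw [Finset.sum_add_distrib, Fin.sum_univ_succ, Fin.sum_univ_castSucc (n := m)]
    have h (i : Fin m) : (i : ℕ) ≠ m := i.2.ne
    simp [h]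
    omega
  · intro v
    rw [hval, Finset.sum_filter, sum_caterpillarLeg m X v]
    unfold pathFlow
    rw [sum_path_neighbours m F (fun j => -F j) v]
    obtain ⟨v, hv⟩ := v
    simp only [hFdef]
    rcases v with _ | v
    · rcases Nat.eq_zero_or_pos m with rfl | hm
      · simp [Finset.sum_range_succ] at hsum ⊢
        linarith
      · simp [Finset.sum_range_succ, hm.ne]
    · by_cases hm : v + 1 = m
      · subst hm
        simp [Finset.sum_range_succ] at hsum ⊢
        linarith
      · simp [hm, Finset.sum_range_succ]
        ring

theorem sum_range_getD (l : List ℤ) (j : ℕ) :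
    ∑ i ∈ Finset.range j, l.getD i 0 = (l.take j).sum := by
  induction l generalizing j with
  | nil => simp
  | cons a l ih =>
    cases j with
    | zero => simp
    | succ j => simp [Finset.sum_range_succ', ← ih, add_comm]

theorem sum_map_sub_const {ι : Type*} (x : ι → ℤ) (k : ℤ) (l : List ι) :
    (l.map fun i => x i - k).sum = (l.map x).sum - k * l.length := by
  induction l with
  | nil => simp
  | cons a l ih =>
    simp only [List.map_cons, List.sum_cons, ih, List.length_cons]
    push_cast
    ring

/-- Let `k ≥ 0`, `n ≥ 3`, and `x : Fin n → ℤ` with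
`∑ x i = k * (n - 2)`. If some entry satisfies `2 * x i₀ < k`, then a
genus-zero leaky cover datum for leaking `k`, degree `x`, and Psi-conditions
`e = 0` (so every vertex is trivalent) exists. -/
theorem caterpillar_exists (k : ℤ) (hk : 0 ≤ k) (n : ℕ) (hn : 3 ≤ n)
    (x : Fin n → ℤ) (hsum : ∑ i, x i = k * ((n : ℤ) - 2))
    (hex : ∃ i₀ : Fin n, 2 * x i₀ < k) :
    Nonempty (LeakyCoverDatum k x (fun _ => 0)) := by
  obtain ⟨i₀, hi₀⟩ := hex
  obtain ⟨m, rfl⟩ : ∃ m, n = m + 3 := ⟨n - 3, by omega⟩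
  have hUsum : ((List.finRange (m + 3)).map fun i => x i - k).sum = -2 * k := by
    have : ((List.finRange (m + 3)).map x).sum = ∑ i, x i := by
      rw [← List.ofFn_eq_map, List.sum_ofFn]
    rw [sum_map_sub_const, this, hsum, List.length_finRange]
    push_cast
    ring
  obtain ⟨l, hl, hgood⟩ : ∃ l : List (Fin (m + 3)), l.Perm (List.finRange (m + 3)) ∧
      ∀ p s, l = p ++ s → 2 ≤ p.length → 2 ≤ s.length →
        (p.map fun i => x i - k).sum ≠ -k := by
    rcases hk.eq_or_lt with rfl | hk
    · exact exists_perm_sum_ne_zero (fun i => x i - 0) _ (by simpa using hUsum)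
        (List.mem_finRange i₀) (by linarith)
    · exact exists_perm_sum_ne_of_pos hk (fun i => x i - k) _ hUsum
        (List.mem_finRange i₀) (by linarith)
  have hlen : l.length = m + 3 := by simpa using hl.length_eq
  set X : ℕ → ℤ := fun j => (l.map x).getD j 0 with hX
  let σ : Fin (m + 3) ≃ Fin (m + 3) := (finCongr hlen.symm).trans
    ((hl.nodup_iff.2 (List.nodup_finRange _)).getEquivOfForallMemList l
      fun i => hl.mem_iff.2 (List.mem_finRange i))
  have hσ : x ∘ σ = fun i : Fin (m + 3) => X i := by
    funext i
    simp [σ, hX, hlen]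
  have hpartial (j : ℕ) : ∑ i ∈ Finset.range j, X i = ((l.take j).map x).sum := by
    rw [hX, sum_range_getD, List.map_take]
  suffices h : Nonempty (LeakyCoverDatum k (x ∘ σ) (fun _ => 0)) from
    h.map (LeakyCoverDatum.reindex σ)
  rw [hσ]
  refine nonempty_leakyCoverDatum_of_sum_ne X ?_ ?_
  · have h := (hl.map fun i => x i - k).sum_eq
    rw [hUsum, sum_map_sub_const, hlen] at h
    rw [hpartial, List.take_of_length_le hlen.le]
    push_cast at h
    linarith
  · intro j hj h
    have htake : (l.take (j + 2)).length = j + 2 := by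
      rw [List.length_take]
      omega
    refine hgood _ _ (List.take_append_drop (j + 2) l).symm (by omega)
      (by rw [List.length_drop]; omega) ?_
    rw [sum_map_sub_const, ← hpartial, h, htake]
    push_cast
    ring
end

section
/- Let k be a positive even integer, n ≥ 3, and let x : Fin n → ℤ be such that for every i there is an integer m_i ≥ 1 with 2·x_i = m_i·k, and Σ_i x_i = k·(n − 2) (equivalently Σ_i m_i = 2n − 4). Let e : Fin n → ℕ with Σ_i e_i ≤ n − 3, and assume there exists a subset I ⊆ {1, …, n} with Σ_{i ∈ I} e_i ≥ (Σ_{i ∈ I} m_i) − #I + 1. Then there exists a genus-zero leaky cover datum for leaking k, degree x, and Psi-conditions e. -/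
/-- The data of a leaky cover with leaking `2`, whose legs are the elements of a finset `S`. -/
structure IsLeakyTree {ι : Type*} (S : Finset ι) (m : ι → ℤ) (e : ι → ℕ) {N : ℕ}
    (a : ι → Fin (N + 1)) (w : Fin (N + 1) → Fin (N + 1) → ℤ) : Prop where
  skew : ∀ u v, w u v = - w v u
  conn : (SimpleGraph.fromRel fun u v => w u v ≠ 0).Connected
  tree : ∑ u, ∑ v, (if w u v ≠ 0 then 1 else 0) = 2 * N
  psi : ∀ v, (∑ u, if w u v ≠ 0 then 1 else 0) + (∑ i ∈ S, if a i = v then 1 else 0)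
    = (∑ i ∈ S, if a i = v then e i else 0) + 3
  balance : ∀ v, (∑ i ∈ S, if a i = v then m i else 0) + ∑ u, w u v
    = 2 * ((((∑ u, if w u v ≠ 0 then 1 else 0)
      + (∑ i ∈ S, if a i = v then 1 else 0) : ℕ) : ℤ) - 2)

/-- Extend a flow by a new vertex `0` sending flow `r` to the old vertex `p`. -/
def attachFlow {N : ℕ} (w : Fin N → Fin N → ℤ) (p : Fin N) (r : ℤ) :
    Fin (N + 1) → Fin (N + 1) → ℤ :=
  fun u v => Fin.cases (Fin.cases 0 (fun q => if q = p then r else 0) v)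
    (fun s => Fin.cases (if s = p then -r else 0) (fun q => w s q) v) u

section attachFlow

variable {N : ℕ} (w : Fin N → Fin N → ℤ) (p : Fin N) (r : ℤ)

@[simp] theorem attachFlow_zero_zero : attachFlow w p r 0 0 = 0 := rfl

@[simp] theorem attachFlow_zero_succ (q : Fin N) :
    attachFlow w p r 0 q.succ = if q = p then r else 0 := rfl

@[simp] theorem attachFlow_succ_zero (q : Fin N) :
    attachFlow w p r q.succ 0 = if q = p then -r else 0 := rfl

@[simp] theorem attachFlow_succ_succ (s q : Fin N) :
    attachFlow w p r s.succ q.succ = w s q := rfl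

theorem ite_attachFlow_zero_zero :
    (if attachFlow w p r 0 0 ≠ 0 then 1 else 0) = 0 := by simp

theorem ite_attachFlow_zero_succ (hr : r ≠ 0) (q : Fin N) :
    (if attachFlow w p r 0 q.succ ≠ 0 then 1 else 0) = if p = q then 1 else 0 := by
  by_cases h : p = q
  · simp [h, hr]
  · simp [h, Ne.symm h]

theorem ite_attachFlow_succ_zero (hr : r ≠ 0) (q : Fin N) :
    (if attachFlow w p r q.succ 0 ≠ 0 then 1 else 0) = if p = q then 1 else 0 := by
  by_cases h : p = q
  · simp [h, hr]
  · simp [h, Ne.symm h]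

theorem ite_attachFlow_succ_succ (s q : Fin N) :
    (if attachFlow w p r s.succ q.succ ≠ 0 then 1 else 0) = if w s q ≠ 0 then 1 else 0 := rfl

theorem attachFlow_connected (hr : r ≠ 0)
    (h : (SimpleGraph.fromRel fun u v => w u v ≠ 0).Connected) :
    (SimpleGraph.fromRel fun u v => attachFlow w p r u v ≠ 0).Connected := by
  let f : (SimpleGraph.fromRel fun u v => w u v ≠ 0) →g
      (SimpleGraph.fromRel fun u v => attachFlow w p r u v ≠ 0) :=
    ⟨Fin.succ, by
      intro u v huv
      simpa [SimpleGraph.fromRel_adj] using huv⟩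
  rw [SimpleGraph.connected_iff_exists_forall_reachable]
  refine ⟨p.succ, fun v => ?_⟩
  refine Fin.cases ?_ (fun q => ?_) v
  · apply SimpleGraph.Adj.reachable
    rw [SimpleGraph.fromRel_adj]
    exact ⟨Fin.succ_ne_zero p, Or.inl (by simpa using hr)⟩
  · exact (h.preconnected p q).map f

end attachFlow

section attachLegs

variable {ι : Type*} [DecidableEq ι] {N : ℕ} {S C : Finset ι} {j : ι}

/-- Move the legs in `insert j C` to a new vertex `0`. -/
def attachLegs (a : ι → Fin N) (C : Finset ι) (j : ι) : ι → Fin (N + 1) :=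
  fun i => if i ∈ insert j C then 0 else (a i).succ

theorem sum_attachLegs_zero {M : Type*} [AddCommMonoid M] (a : ι → Fin N)
    (hCS : C ⊆ S) (hjS : j ∈ S) (hjC : j ∉ C) (g : ι → M) :
    (∑ i ∈ S, if attachLegs a C j i = 0 then g i else 0) = g j + ∑ i ∈ C, g i := by
  rw [← Finset.sum_insert hjC, ← Finset.sum_filter]
  congr 1
  ext i
  rw [Finset.mem_filter]
  have := Finset.insert_subset hjS hCS
  by_cases hi : i ∈ insert j C
  · simp [attachLegs, this hi, hi, -Finset.mem_insert]
  · simp [attachLegs, hi, Fin.succ_ne_zero, -Finset.mem_insert]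

theorem sum_attachLegs_succ {M : Type*} [AddCommMonoid M] (a : ι → Fin N)
    (hCS : C ⊆ S) (hjS : j ∈ S) (hjC : j ∉ C) (g : ι → M) (r : M) (v : Fin N) :
    (∑ i ∈ S \ C, if a i = v then Function.update g j r i else 0)
      = (∑ i ∈ S, if attachLegs a C j i = v.succ then g i else 0) + if a j = v then r else 0 := by
  have hj : j ∈ S \ C := Finset.mem_sdiff.2 ⟨hjS, hjC⟩
  rw [← Finset.sum_sdiff hCS, ← Finset.sum_erase_add _ _ hj, ← Finset.sum_erase_add (S \ C) _ hj]
  have h1 : (∑ i ∈ C, if attachLegs a C j i = v.succ then g i else 0) = 0 :=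
    Finset.sum_eq_zero fun i hi => by
      simp [attachLegs, hi, (Fin.succ_ne_zero v).symm]
  have h2 : (if attachLegs a C j j = v.succ then g j else 0) = 0 := by
    simp [attachLegs, (Fin.succ_ne_zero v).symm]
  rw [h1, h2, add_zero, add_zero, Function.update_self]
  congr 1
  refine Finset.sum_congr rfl fun i hi => ?_
  have hij : i ≠ j := Finset.ne_of_mem_erase hi
  have hiC : i ∉ C := (Finset.mem_sdiff.1 (Finset.mem_of_mem_erase hi)).2
  simp [attachLegs, hij, hiC]

theorem IsLeakyTree.attach {m : ι → ℤ} {e : ι → ℕ} {a : ι → Fin (N + 1)}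
    {w : Fin (N + 1) → Fin (N + 1) → ℤ} {r : ℤ}
    (hCS : C ⊆ S) (hjS : j ∈ S) (hjC : j ∉ C) (heC : ∀ i ∈ C, e i = 0)
    (hcard : C.card = e j + 1) (hr : r ≠ 0) (hrm : r = m j + ∑ i ∈ C, m i - 2 * C.card)
    (h : IsLeakyTree (S \ C) (Function.update m j r) (Function.update e j 0) a w) :
    IsLeakyTree S m e (attachLegs a C j) (attachFlow w (a j) r) := by
  have hC0 : ∑ i ∈ C, e i = 0 := Finset.sum_eq_zero heC
  have hcount (v : Fin (N + 1)) : (∑ i ∈ S \ C, if a i = v then 1 else 0)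
      = (∑ i ∈ S, if attachLegs a C j i = v.succ then 1 else 0) + if a j = v then 1 else 0 := by
    rw [← sum_attachLegs_succ a hCS hjS hjC (fun _ => 1) 1 v]
    simp
  refine ⟨?_, attachFlow_connected w _ r hr h.conn, ?_, ?_, ?_⟩
  · intro u v
    refine Fin.cases ?_ (fun u => ?_) u <;> refine Fin.cases ?_ (fun v => ?_) v
    · simp
    · simp only [attachFlow_zero_succ, attachFlow_succ_zero]; split_ifs <;> simp
    · simp only [attachFlow_zero_succ, attachFlow_succ_zero]; split_ifs <;> simp
    · simpa using h.skew u v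
  · have ht := h.tree
    simp only [Fin.sum_univ_succ (n := N + 1), ite_attachFlow_zero_zero,
      ite_attachFlow_zero_succ w _ r hr, ite_attachFlow_succ_zero w _ r hr,
      ite_attachFlow_succ_succ, Finset.sum_add_distrib, ht, Finset.sum_ite_eq, Finset.mem_univ,
      if_true]
    ring
  · intro v
    refine Fin.cases ?_ (fun v => ?_) v
    · rw [sum_attachLegs_zero a hCS hjS hjC, sum_attachLegs_zero a hCS hjS hjC]
      simp only [Fin.sum_univ_succ (n := N + 1), ite_attachFlow_zero_zero,
        ite_attachFlow_succ_zero w _ r hr]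
      simp [hC0, hcard]
      ring
    · have hp := h.psi v
      rw [sum_attachLegs_succ a hCS hjS hjC, hcount] at hp
      simp only [Fin.sum_univ_succ (n := N + 1), ite_attachFlow_succ_succ,
        ite_attachFlow_zero_succ w _ r hr]
      simp only [ite_self, add_zero] at hp
      omega
  · intro v
    refine Fin.cases ?_ (fun v => ?_) v
    · rw [sum_attachLegs_zero a hCS hjS hjC, sum_attachLegs_zero a hCS hjS hjC]
      simp only [Fin.sum_univ_succ (n := N + 1), ite_attachFlow_zero_zero,
        ite_attachFlow_succ_zero w _ r hr]
      simp [hrm]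
      ring
    · have hb := h.balance v
      rw [sum_attachLegs_succ a hCS hjS hjC, hcount] at hb
      simp only [Fin.sum_univ_succ (n := N + 1), ite_attachFlow_succ_succ,
        ite_attachFlow_zero_succ w _ r hr]
      simp only [attachFlow_zero_succ, attachFlow_succ_succ, eq_comm (a := v)]
      push_cast at hb ⊢
      linarith

theorem exists_isLeakyTree (N : ℕ) (S : Finset ι) (m : ι → ℤ) (e : ι → ℕ)
    (hm : ∀ i ∈ S, 1 ≤ m i) (hsum : ∑ i ∈ S, m i = 2 * (S.card : ℤ) - 4)
    (he : ∑ i ∈ S, e i + N + 3 = S.card) (hex : ∃ i ∈ S, m i ≤ e i) :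
    ∃ (a : ι → Fin (N + 1)) (w : Fin (N + 1) → Fin (N + 1) → ℤ), IsLeakyTree S m e a w := by
  induction N generalizing S m e with
  | zero =>
    have : Subsingleton (Fin (0 + 1)) := inferInstanceAs (Subsingleton (Fin 1))
    refine ⟨fun _ => 0, fun _ _ => 0, by simp, ?_, by simp, ?_, ?_⟩
    · exact ⟨fun u v => by rw [Subsingleton.elim u v]⟩
    · intro v
      simp [Subsingleton.elim v 0]
      omega
    · intro v
      simp [Subsingleton.elim v 0, hsum]
      ring
  | succ N ih =>
    obtain ⟨i₀, hi₀, hmi₀⟩ := hex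
    have heZ : ∑ i ∈ S, (e i : ℤ) + N + 4 = S.card := by
      rw [← he]; push_cast; ring
    obtain ⟨j, hjS, hj⟩ : ∃ j ∈ S, 0 < m j - 1 - e j := by
      by_contra! hneg
      have hlt : ∑ i ∈ S, (m i - 1 - e i) < ∑ i ∈ S, (0 : ℤ) :=
        Finset.sum_lt_sum hneg ⟨i₀, hi₀, by omega⟩
      simp only [Finset.sum_sub_distrib, hsum, Finset.sum_const, nsmul_eq_mul, mul_one,
        mul_zero] at hlt
      omega
    have hZ : e j + 1 ≤ ((S.erase j).filter fun i => e i = 0).card := by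
      have h1 : ∑ i ∈ S.erase j, (1 : ℤ) ≤
          ∑ i ∈ S.erase j, ((e i : ℤ) + if e i = 0 then 1 else 0) :=
        Finset.sum_le_sum fun i _ => by split_ifs <;> omega
      have h2 := Finset.sum_erase_add S (fun i => (e i : ℤ)) hjS
      have h3 := Finset.card_erase_add_one hjS
      rw [Finset.sum_add_distrib, Finset.sum_boole] at h1
      simp only [Finset.sum_const, nsmul_eq_mul, mul_one] at h1
      omega
    obtain ⟨C, hCZ, hCcard⟩ := Finset.exists_subset_card_eq hZ
    have hC (i) (hi : i ∈ C) : i ≠ j ∧ i ∈ S ∧ e i = 0 := by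
      simpa [and_assoc] using hCZ hi
    have hCS : C ⊆ S := fun i hi => (hC i hi).2.1
    have hjC : j ∉ C := fun hi => (hC j hi).1 rfl
    have heC (i) (hi : i ∈ C) : e i = 0 := (hC i hi).2.2
    have hj' : j ∈ S \ C := Finset.mem_sdiff.2 ⟨hjS, hjC⟩
    have hmC : (C.card : ℤ) ≤ ∑ i ∈ C, m i := by
      simpa using Finset.sum_le_sum fun i hi => hm i (hCS hi)
    have hcardS := Finset.card_sdiff_add_card_eq_card hCS
    obtain ⟨r, hr⟩ : ∃ r, r = m j + ∑ i ∈ C, m i - 2 * C.card := ⟨_, rfl⟩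
    have hr1 : 1 ≤ r := by omega
    have hm' : ∀ i ∈ S \ C, 1 ≤ Function.update m j r i := by
      intro i hi
      by_cases hij : i = j
      · simpa [hij] using hr1
      · simpa [hij] using hm i (Finset.mem_sdiff.1 hi).1
    have hsum' : ∑ i ∈ S \ C, Function.update m j r i = 2 * ((S \ C).card : ℤ) - 4 := by
      have h1 := Finset.sum_sdiff (f := m) hCS
      have h2 := Finset.sum_erase_add _ m hj'
      rw [Finset.sum_update_of_mem hj', ← Finset.erase_eq]
      omega
    have he' : ∑ i ∈ S \ C, Function.update e j 0 i + N + 3 = (S \ C).card := by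
      have h1 := Finset.sum_sdiff (f := e) hCS
      have h2 := Finset.sum_erase_add _ e hj'
      rw [Finset.sum_eq_zero heC] at h1
      rw [Finset.sum_update_of_mem hj', ← Finset.erase_eq]
      omega
    have hex' : ∃ i ∈ S \ C, Function.update m j r i ≤ (Function.update e j 0 i : ℕ) := by
      have hij : i₀ ≠ j := by rintro rfl; omega
      have hiC : i₀ ∉ C := fun hi => by
        have := heC _ hi
        have := hm _ hi₀
        omega
      exact ⟨i₀, Finset.mem_sdiff.2 ⟨hi₀, hiC⟩, by simpa [hij] using hmi₀⟩
    obtain ⟨a, w, h⟩ := ih (S \ C) _ _ hm' hsum' he' hex'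
    exact ⟨_, _, h.attach hCS hjS hjC heC hCcard (by omega) hr⟩

end attachLegs

/-- Scaling the flow of a leaky tree with leaking `2` by `h` gives a cover with leaking `2 * h`. -/
def IsLeakyTree.toLeakyCoverDatum {n N : ℕ} {m : Fin n → ℤ} {e : Fin n → ℕ}
    {a : Fin n → Fin (N + 1)} {w : Fin (N + 1) → Fin (N + 1) → ℤ}
    (H : IsLeakyTree Finset.univ m e a w) {h : ℤ} (hh : h ≠ 0) :
    LeakyCoverDatum (2 * h) (fun i => h * m i) e where
  N := N + 1
  Npos := N.succ_pos
  a := a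
  w u v := h * w u v
  skew u v := by rw [H.skew u v, mul_neg]
  conn := by simpa [hh] using H.conn
  tree := by
    rw [Finset.card_filter, Fintype.sum_prod_type]
    simpa [hh] using H.tree
  psi v := by
    simp only [Finset.card_filter, Finset.sum_filter]
    simpa [hh] using H.psi v
  balance v := by
    have hb := H.balance v
    simp only [Finset.card_filter, Finset.sum_filter, mul_ne_zero_iff, ne_eq, hh,
      not_false_eq_true, true_and, ← Finset.mul_sum] at hb ⊢
    linear_combination h * hb

/-- Let `k` be a positive even integer, `n ≥ 3`, and
`x : Fin n → ℤ` with every entry a positive multiple of `k/2` (integrally: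
`2 * x i = m i * k` with `m i ≥ 1`), summing to `k * (n - 2)`. If
`e : Fin n → ℕ` has `∑ e i ≤ n - 3` and there is a subset `I` with
`∑_{i ∈ I} e i ≥ (∑_{i ∈ I} m i) - #I + 1`, then a genus-zero leaky cover
datum for leaking `k`, degree `x`, and Psi-conditions `e` exists. -/
theorem positivity_cover_exists (k : ℤ) (hkpos : 0 < k) (hkeven : Even k)
    (n : ℕ) (hn : 3 ≤ n) (x : Fin n → ℤ) (m : Fin n → ℤ)
    (hm : ∀ i, 1 ≤ m i) (hxm : ∀ i, 2 * x i = m i * k)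
    (hsum : ∑ i, x i = k * ((n : ℤ) - 2))
    (e : Fin n → ℕ) (he : (∑ i, (e i : ℤ)) ≤ (n : ℤ) - 3)
    (hI : ∃ I : Finset (Fin n),
      (∑ i ∈ I, m i) - (I.card : ℤ) + 1 ≤ ∑ i ∈ I, (e i : ℤ)) :
    Nonempty (LeakyCoverDatum k x e) := by
  obtain ⟨h, rfl⟩ := hkeven
  have hh : 0 < h := by omega
  have hx : x = fun i => h * m i := by
    funext i
    linarith [hxm i]
  subst hx
  rw [← Finset.mul_sum] at hsum
  have hsum' : ∑ i, m i = 2 * (n : ℤ) - 4 :=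
    mul_left_cancel₀ hh.ne' (by linear_combination hsum)
  obtain ⟨I, hI⟩ := hI
  obtain ⟨i, -, hi⟩ : ∃ i ∈ I, m i ≤ e i := by
    by_contra! hlt
    have : ∑ i ∈ I, ((e i : ℤ) + 1) ≤ ∑ i ∈ I, m i := Finset.sum_le_sum hlt
    simp only [Finset.sum_add_distrib, Finset.sum_const, nsmul_eq_mul, mul_one] at this
    omega
  have heN : ∑ i, e i + 3 ≤ n := by
    zify
    linarith
  obtain ⟨a, w, H⟩ := exists_isLeakyTree (n - 3 - ∑ i, e i) Finset.univ m e (fun i _ => hm i)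
    (by simpa using hsum') (by rw [Finset.card_univ, Fintype.card_fin]; omega)
    ⟨i, Finset.mem_univ i, hi⟩
  rw [← two_mul]
  exact ⟨H.toLeakyCoverDatum hh.ne'⟩
end
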